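/- Let (m_n) and (k_n) be sequences of positive integers with k_n → ∞ as n → ∞, and for each n let P_n be a real symmetric idempotent m_n × m_n matrix of rank k_n (so trace(P_n) = k_n). Suppose there is a constant c > 0 such that σ_n² := (2/k_n) · Σ_{i ≠ j} (P_n)_{ij}² ≥ c for every n. For each n let r be uniformly distributed on {−1,1}^{m_n} and let μ_n be the law of the real random variable (k_n σ_n²)^{−1/2} · (rᵀ P_n r − k_n). Then μ_n converges weakly to the standard normal distribution N(0,1) as n → ∞. -/

import Mathlib

open Matrix MeasureTheory Filter Topology

/-- The ±1 sign vector associated to a Boolean vector. -/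
noncomputable def signVec {m : ℕ} (s : Fin m → Bool) : Fin m → ℝ :=
  fun i => if s i then 1 else -1

section

open Finset BigOperators

lemma expect_abs_le_sqrt {ι : Type*} [Fintype ι] [Nonempty ι] (f : ι → ℝ) :
    𝔼 i, |f i| ≤ √(𝔼 i, f i ^ 2) := by
  refine Real.le_sqrt_of_sq_le ?_
  set a := 𝔼 i, |f i| with ha
  have h : 0 ≤ 𝔼 i, (|f i| - a) ^ 2 := expect_nonneg fun i _ => sq_nonneg _
  have h' : ∀ i, (|f i| - a) ^ 2 = f i ^ 2 - 2 * a * |f i| + a ^ 2 := fun i => by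
    rw [← sq_abs (f i)]; ring
  simp_rw [h', expect_add_distrib, expect_sub_distrib, ← mul_expect, Fintype.expect_const,
    ← ha] at h
  linarith

lemma abs_sin_sub_mul_cos_le (y : ℝ) : |Real.sin y - y * Real.cos y| ≤ 2 * |y| ^ 3 := by
  rcases le_total |y| 1 with h | h
  · have h1 := abs_le.1 (Real.sin_bound h)
    have h2 := Real.one_sub_sq_div_two_le_cos (x := y)
    have h3 := Real.cos_le_one y
    have h4 : |Real.sin y - y| ≤ |y| ^ 3 := by
      have e : Real.sin y - y = (Real.sin y - (y - y ^ 3 / 6)) - y ^ 3 / 6 := by ring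
      rw [e]
      refine (abs_sub _ _).trans ?_
      have h5 : |y| ^ 5 ≤ |y| ^ 3 := pow_le_pow_of_le_one (abs_nonneg _) h (by norm_num)
      rw [abs_div, abs_pow, abs_of_pos (by norm_num : (0:ℝ) < 6)]
      have := Real.sin_bound h
      have : 0 ≤ |y| ^ 3 := by positivity
      linarith
    have h6 : |y * (1 - Real.cos y)| ≤ |y| ^ 3 := by
      rw [abs_mul, abs_of_nonneg (by linarith : 0 ≤ 1 - Real.cos y), pow_succ' |y|, sq_abs]
      gcongr
      nlinarith [sq_nonneg y]
    calc |Real.sin y - y * Real.cos y| = |(Real.sin y - y) + y * (1 - Real.cos y)| := by ring_nf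
      _ ≤ _ := (abs_add_le _ _).trans (by linarith)
  · have h1 := Real.abs_sin_le_one y
    have h2 := Real.abs_cos_le_one y
    have h3 : |y * Real.cos y| ≤ |y| := by
      rw [abs_mul]; exact mul_le_of_le_one_right (abs_nonneg _) h2
    have h4 : |y| ≤ |y| ^ 3 := le_self_pow₀ h (by norm_num)
    exact (abs_sub _ _).trans (by linarith)

lemma norm_stein_pair_le (u w x : ℝ) :
    ‖((x : ℂ) - Complex.I * u * x ^ 2) * Complex.exp (Complex.I * u * (w + x)) +
      (-(x : ℂ) - Complex.I * u * x ^ 2) * Complex.exp (Complex.I * u * (w - x))‖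
      ≤ 4 * |u| ^ 3 * x ^ 4 := by
  have key : ((x : ℂ) - Complex.I * u * x ^ 2) * Complex.exp (Complex.I * u * (w + x)) +
      (-(x : ℂ) - Complex.I * u * x ^ 2) * Complex.exp (Complex.I * u * (w - x)) =
      Complex.exp ((u * w : ℝ) * Complex.I) * (2 * Complex.I) *
        ((x * (Real.sin (u * x) - u * x * Real.cos (u * x)) : ℝ) : ℂ) := by
    have e1 : Complex.I * u * (w + x) = u * w * Complex.I + (u * x) * Complex.I := by ring
    have e2 : Complex.I * u * (w - x) = u * w * Complex.I + (-(u * x)) * Complex.I := by ring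
    rw [e1, e2, Complex.exp_add, Complex.exp_add, Complex.exp_mul_I (u * x),
      Complex.exp_mul_I (-(u * x)), Complex.cos_neg, Complex.sin_neg]
    push_cast
    ring
  rw [key, norm_mul, norm_mul, Complex.norm_exp_ofReal_mul_I, Complex.norm_real, Real.norm_eq_abs,
    abs_mul]
  have h := abs_sin_sub_mul_cos_le (u * x)
  have e : |x| ^ 4 = x ^ 4 := by rw [Even.pow_abs (by decide)]
  rw [abs_mul] at h
  simp only [norm_mul, Complex.norm_ofNat, Complex.norm_I]
  calc 1 * (2 * 1) * (|x| * |Real.sin (u * x) - u * x * Real.cos (u * x)|)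
      ≤ 1 * (2 * 1) * (|x| * (2 * (|u| * |x|) ^ 3)) := by gcongr
    _ = 4 * |u| ^ 3 * |x| ^ 4 := by ring
    _ = _ := by rw [e]

/-- Change the sign of the `i`-th coordinate. -/
def flipSign {m : ℕ} (i : Fin m) : (Fin m → Bool) ≃ (Fin m → Bool) :=
  Function.Involutive.toPerm (fun s => Function.update s i (!s i)) fun s => by simp

lemma flipSign_apply {m : ℕ} (i : Fin m) (s : Fin m → Bool) :
    flipSign i s = Function.update s i (!s i) := rfl

lemma signVec_flipSign {m : ℕ} (i : Fin m) (s : Fin m → Bool) :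
    signVec (flipSign i s) = signVec s - Pi.single i (2 * signVec s i) := by
  ext j
  by_cases h : j = i
  · subst h
    cases hs : s j <;> simp [flipSign_apply, signVec, hs] <;> norm_num
  · simp [flipSign_apply, signVec, h]

lemma expect_flipSign {m : ℕ} {M : Type*} [AddCommMonoid M] [Module ℚ≥0 M] (i : Fin m)
    (F : (Fin m → Bool) → M) : 𝔼 s, F (flipSign i s) = 𝔼 s, F s :=
  Fintype.expect_equiv (flipSign i) _ _ fun _ => rfl

lemma signVec_mul_self {m : ℕ} (s : Fin m → Bool) (i : Fin m) : signVec s i * signVec s i = 1 := by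
  unfold signVec; split_ifs <;> norm_num

lemma expect_eq_zero_of_flipSign {m : ℕ} (i : Fin m) (F : (Fin m → Bool) → ℝ)
    (h : ∀ s, F (flipSign i s) = -F s) : 𝔼 s, F s = 0 := by
  have h1 := expect_flipSign i F
  simp_rw [h, expect_neg_distrib] at h1
  linarith

lemma signVec_flipSign_self {m : ℕ} (i : Fin m) (s : Fin m → Bool) :
    signVec (flipSign i s) i = -signVec s i := by
  simp [signVec_flipSign]; ring

lemma signVec_flipSign_of_ne {m : ℕ} {i j : Fin m} (h : j ≠ i) (s : Fin m → Bool) :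
    signVec (flipSign i s) j = signVec s j := by
  simp [signVec_flipSign, h]

lemma expect_signVec_mul {m : ℕ} (i j : Fin m) :
    𝔼 s, signVec s i * signVec s j = if i = j then 1 else 0 := by
  split_ifs with h
  · subst h; simp [signVec_mul_self]
  · exact expect_eq_zero_of_flipSign i _ fun s => by
      rw [signVec_flipSign_self, signVec_flipSign_of_ne (Ne.symm h)]; ring

lemma expect_signVec_four {m : ℕ} (i j k l : Fin m) :
    𝔼 s, (signVec s i * signVec s j) * (signVec s k * signVec s l) =
      (if i = j then if k = l then 1 else 0 else 0) +
      (if i = k then if j = l then 1 else 0 else 0) +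
      (if i = l then if j = k then 1 else 0 else 0) -
      2 * (if i = j then if i = k then if i = l then 1 else 0 else 0 else 0) := by
  by_cases hij : i = j
  · subst hij
    simp only [signVec_mul_self, one_mul, expect_signVec_mul]
    by_cases h1 : i = k <;> by_cases h2 : i = l <;> simp_all
    norm_num
  by_cases hik : i = k
  · subst hik
    have : ∀ s : Fin m → Bool, (signVec s i * signVec s j) * (signVec s i * signVec s l) =
        signVec s j * signVec s l := fun s => by
      linear_combination (signVec s j * signVec s l) * signVec_mul_self s i
    simp only [this, expect_signVec_mul]
    by_cases h1 : i = l <;> by_cases h2 : j = l <;> simp_all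
  by_cases hil : i = l
  · subst hil
    have : ∀ s : Fin m → Bool, (signVec s i * signVec s j) * (signVec s k * signVec s i) =
        signVec s j * signVec s k := fun s => by
      linear_combination (signVec s j * signVec s k) * signVec_mul_self s i
    simp only [this, expect_signVec_mul]
    simp [hij, hik]
  simp only [hij, hik, hil, if_false]
  rw [expect_eq_zero_of_flipSign i _ fun s => ?_]
  · simp
  rw [signVec_flipSign_self, signVec_flipSign_of_ne (Ne.symm hij),
    signVec_flipSign_of_ne (Ne.symm hik), signVec_flipSign_of_ne (Ne.symm hil)]
  ring

lemma quadForm_eq_sum {m : ℕ} (Q : Matrix (Fin m) (Fin m) ℝ) (v : Fin m → ℝ) :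
    v ⬝ᵥ Q *ᵥ v = ∑ i, ∑ j, Q i j * (v i * v j) := by
  simp only [dotProduct, mulVec, Finset.mul_sum]
  refine sum_congr rfl fun i _ => sum_congr rfl fun j _ => by ring

lemma expect_quadForm {m : ℕ} (Q : Matrix (Fin m) (Fin m) ℝ) :
    𝔼 s, signVec s ⬝ᵥ Q *ᵥ signVec s = Q.trace := by
  simp only [quadForm_eq_sum, expect_sum_comm, ← mul_expect, expect_signVec_mul]
  simp [Matrix.trace]

lemma expect_quadForm_sq_le {m : ℕ} (Q : Matrix (Fin m) (Fin m) ℝ) (hQ : Q.IsSymm) :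
    𝔼 s, (signVec s ⬝ᵥ Q *ᵥ signVec s) ^ 2 ≤ Q.trace ^ 2 + 2 * ∑ i, ∑ j, Q i j ^ 2 := by
  have h : ∀ s : Fin m → Bool, (signVec s ⬝ᵥ Q *ᵥ signVec s) ^ 2 = ∑ i, ∑ j, ∑ k, ∑ l,
      Q i j * Q k l * ((signVec s i * signVec s j) * (signVec s k * signVec s l)) := fun s => by
    rw [quadForm_eq_sum, sq]
    simp only [Finset.sum_mul]
    refine sum_congr rfl fun i _ => sum_congr rfl fun j _ => ?_
    simp only [Finset.mul_sum]
    refine sum_congr rfl fun k _ => sum_congr rfl fun l _ => by ring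
  simp only [h, expect_sum_comm, ← mul_expect, expect_signVec_four]
  have hsq : ∀ i j, Q j i = Q i j := fun i j => hQ.apply i j
  simp only [mul_sub, mul_add, sum_sub_distrib, sum_add_distrib, mul_ite, mul_one, mul_zero,
    sum_ite_eq, sum_ite_irrel, sum_const_zero, mem_univ, if_true]
  have h0 : 0 ≤ ∑ i, Q i i * Q i i * 2 := sum_nonneg fun i _ => by
    have := mul_self_nonneg (Q i i); linarith
  have h1 : ∑ i, ∑ k, Q i i * Q k k = Q.trace ^ 2 := by
    simp [Matrix.trace, sq, sum_mul_sum]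
  have h2 : ∑ i, ∑ j, Q i j * Q j i = ∑ i, ∑ j, Q i j ^ 2 := by
    simp [hsq, sq]
  have h3 : ∑ i, ∑ j, Q i j * Q i j = ∑ i, ∑ j, Q i j ^ 2 := by
    simp [sq]
  simp only [h1, h2, h3]
  linarith

lemma norm_sub_exp_neg_sq_le {φ φ' : ℝ → ℂ} {K t : ℝ} (hφ : ∀ u, HasDerivAt φ (φ' u) u)
    (h0 : φ 0 = 1) (hK : ∀ u, |u| ≤ |t| → ‖φ' u + u * φ u‖ ≤ K) :
    ‖φ t - Complex.exp (-(t ^ 2 / 2))‖ ≤ K * |t| := by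
  have hd : ∀ u : ℝ, HasDerivAt (fun u : ℝ => Complex.exp (u ^ 2 / 2) * φ u)
      (Complex.exp (u ^ 2 / 2) * (φ' u + u * φ u)) u := fun u => by
    have h1 : HasDerivAt (fun u : ℝ => ((u : ℂ) ^ 2 / 2)) (u : ℂ) u := by
      have := ((Complex.ofRealCLM.hasDerivAt (x := u)).pow 2).div_const 2
      simpa using this
    exact (h1.cexp.mul (hφ u)).congr_deriv (by ring)
  have hn : ∀ u : ℝ, ‖Complex.exp ((u : ℂ) ^ 2 / 2)‖ = Real.exp (u ^ 2 / 2) := fun u => by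
    rw [Complex.norm_exp]; norm_cast
  have hK0 : 0 ≤ K := (norm_nonneg _).trans (hK t le_rfl)
  have hb := (convex_Icc (-|t|) |t|).norm_image_sub_le_of_norm_hasDerivWithin_le
    (f := fun u : ℝ => Complex.exp (u ^ 2 / 2) * φ u) (C := Real.exp (t ^ 2 / 2) * K)
    (x := 0) (y := t) (fun u _ => (hd u).hasDerivWithinAt) (fun u hu => ?_)
    (by simp) (abs_le.1 le_rfl)
  · have e : φ t - Complex.exp (-(t ^ 2 / 2)) = Complex.exp (-((t : ℂ) ^ 2 / 2)) *
        (Complex.exp ((t : ℂ) ^ 2 / 2) * φ t - Complex.exp (((0 : ℝ) : ℂ) ^ 2 / 2) * φ 0) := by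
      rw [mul_sub, ← mul_assoc, ← Complex.exp_add, h0]
      simp
    have hn' : ‖Complex.exp (-((t : ℂ) ^ 2 / 2))‖ = Real.exp (-(t ^ 2 / 2)) := by
      rw [Complex.norm_exp]; norm_cast
    rw [e, norm_mul, hn']
    calc _ ≤ Real.exp (-(t ^ 2 / 2)) * (Real.exp (t ^ 2 / 2) * K * ‖t - 0‖) := by gcongr
      _ = K * |t| := by
        rw [sub_zero, Real.norm_eq_abs, ← mul_assoc, ← mul_assoc, ← Real.exp_add]; simp
  · have hu' : |u| ≤ |t| := abs_le.2 hu
    rw [norm_mul, hn]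
    gcongr Real.exp (?_ / 2) * ?_
    · exact sq_le_sq.2 hu'
    · exact hK u hu'

lemma hasDerivAt_expect_cexp {ι : Type*} [Fintype ι] (W : ι → ℝ) (u : ℝ) :
    HasDerivAt (fun u : ℝ => 𝔼 i, Complex.exp (Complex.I * u * W i))
      (𝔼 i, Complex.I * W i * Complex.exp (Complex.I * u * W i)) u := by
  simp only [Fintype.expect_eq_sum_div_card]
  refine (HasDerivAt.fun_sum fun i _ => ?_).div_const _
  have h : HasDerivAt (fun u : ℝ => Complex.I * u * W i) (Complex.I * W i) u := by
    simpa using (((Complex.ofRealCLM.hasDerivAt (x := u)).const_mul Complex.I).mul_const (W i : ℂ))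
  exact h.cexp.congr_deriv (by ring)

section Stein

variable {m : ℕ} {B : Matrix (Fin m) (Fin m) ℝ}

lemma mulVec_flipSign_self {i : Fin m} (hB : B i i = 0) (s : Fin m → Bool) :
    (B *ᵥ signVec (flipSign i s)) i = (B *ᵥ signVec s) i := by
  rw [signVec_flipSign, mulVec_sub]
  simp [mulVec_single, hB]

lemma quadForm_flipSign (hs : B.IsSymm) {i : Fin m} (hB : B i i = 0) (s : Fin m → Bool) :
    signVec (flipSign i s) ⬝ᵥ B *ᵥ signVec (flipSign i s) =
      signVec s ⬝ᵥ B *ᵥ signVec s - 2 * (2 * (signVec s i * (B *ᵥ signVec s) i)) := by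
  have h : signVec s ⬝ᵥ B *ᵥ Pi.single i (2 * signVec s i) =
      2 * signVec s i * (B *ᵥ signVec s) i := by
    rw [dotProduct_mulVec, dotProduct_single, ← mulVec_transpose, hs.eq, mul_comm]
  have h' : ∀ v, Pi.single i (2 * signVec s i) ⬝ᵥ v = 2 * signVec s i * v i := fun v => by
    simp
  have h2 := mulVec_flipSign_self hB s
  rw [signVec_flipSign] at h2 ⊢
  rw [sub_dotProduct, h', h2, mulVec_sub, dotProduct_sub, h]
  ring

lemma norm_expect_stein_coord_le (hs : B.IsSymm) {i : Fin m} (hB : B i i = 0) (u : ℝ) :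
    ‖𝔼 s, ((2 * (signVec s i * (B *ᵥ signVec s) i) : ℝ) -
        Complex.I * u * 4 * ((B *ᵥ signVec s) i ^ 2 : ℝ)) *
        Complex.exp (Complex.I * u * (signVec s ⬝ᵥ B *ᵥ signVec s : ℝ))‖ ≤
      32 * |u| ^ 3 * 𝔼 s, (B *ᵥ signVec s) i ^ 4 := by
  set F : (Fin m → Bool) → ℂ := fun s => ((2 * (signVec s i * (B *ᵥ signVec s) i) : ℝ) -
        Complex.I * u * 4 * ((B *ᵥ signVec s) i ^ 2 : ℝ)) *
        Complex.exp (Complex.I * u * (signVec s ⬝ᵥ B *ᵥ signVec s : ℝ)) with hF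
  have hpt : ∀ s, ‖F s + F (flipSign i s)‖ ≤ 64 * |u| ^ 3 * (B *ᵥ signVec s) i ^ 4 := fun s => by
    have h1 := signVec_mul_self s i
    set a := signVec s i with ha
    set l := (B *ᵥ signVec s) i with hl
    set w := signVec s ⬝ᵥ B *ᵥ signVec s with hw
    have := norm_stein_pair_le u (w - 2 * (a * l)) (2 * (a * l))
    have hx2 : (2 * (a * l)) ^ 2 = 4 * l ^ 2 := by linear_combination (4 * l ^ 2) * h1
    have hx4 : (2 * (a * l)) ^ 4 = 16 * l ^ 4 := by
      rw [show (2 * (a * l)) ^ 4 = ((2 * (a * l)) ^ 2) ^ 2 by ring, hx2]; ring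
    have hx2' : ((2 * (a * l) : ℝ) : ℂ) ^ 2 = 4 * ((l ^ 2 : ℝ) : ℂ) := by exact_mod_cast hx2
    rw [hx4, hx2'] at this
    refine le_of_eq_of_le ?_ (this.trans_eq (by ring))
    congr 1
    simp only [hF]
    rw [quadForm_flipSign hs hB, mulVec_flipSign_self hB, signVec_flipSign_self, ← ha, ← hl, ← hw]
    congr 2
    · ring
    · congr 1; push_cast; ring
    · push_cast; ring
    · congr 1; push_cast; ring
  have h2 : 𝔼 s, F s = (𝔼 s, (F s + F (flipSign i s))) / 2 := by
    rw [expect_add_distrib, expect_flipSign i F]; ring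
  rw [h2, norm_div, Complex.norm_ofNat]
  have h3 : ‖𝔼 s, (F s + F (flipSign i s))‖ ≤ 64 * |u| ^ 3 * 𝔼 s, (B *ᵥ signVec s) i ^ 4 := by
    rw [mul_expect]
    exact (RCLike.norm_expect_le (K := ℂ)).trans (expect_le_expect fun s _ => hpt s)
  linarith

lemma expect_mulVec_pow_four_le (i : Fin m) :
    𝔼 s, (B *ᵥ signVec s) i ^ 4 ≤ 3 * (∑ j, B i j ^ 2) ^ 2 := by
  have h := expect_quadForm_sq_le (vecMulVec (B i) (B i))
    (by ext j k; simp [vecMulVec_apply, mul_comm])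
  have e1 : ∀ s : Fin m → Bool, (signVec s ⬝ᵥ vecMulVec (B i) (B i) *ᵥ signVec s) ^ 2 =
      (B *ᵥ signVec s) i ^ 4 := fun s => by
    rw [vecMulVec_mulVec]
    simp only [mulVec, op_smul_eq_smul, dotProduct_smul, smul_eq_mul]
    rw [dotProduct_comm (signVec s)]
    ring
  have e2 : ∑ j, ∑ k, vecMulVec (B i) (B i) j k ^ 2 = (∑ j, B i j ^ 2) ^ 2 := by
    simp only [vecMulVec_apply, mul_pow, sq (∑ j, B i j ^ 2), sum_mul_sum]
  have e3 : (vecMulVec (B i) (B i)).trace = ∑ j, B i j ^ 2 := by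
    simp [Matrix.trace, vecMulVec_apply, sq]
  simp only [e1, e2, e3] at h
  linarith

lemma expect_abs_quadForm_sub_trace_le {Q : Matrix (Fin m) (Fin m) ℝ} (hQ : Q.IsSymm) :
    𝔼 s, |signVec s ⬝ᵥ Q *ᵥ signVec s - Q.trace| ≤ √(2 * ∑ i, ∑ j, Q i j ^ 2) := by
  refine (expect_abs_le_sqrt _).trans (Real.sqrt_le_sqrt ?_)
  have h : ∀ s : Fin m → Bool, (signVec s ⬝ᵥ Q *ᵥ signVec s - Q.trace) ^ 2 =
      (signVec s ⬝ᵥ Q *ᵥ signVec s) ^ 2 - 2 * Q.trace * (signVec s ⬝ᵥ Q *ᵥ signVec s) +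
        Q.trace ^ 2 := fun s => by ring
  simp_rw [h, expect_add_distrib, expect_sub_distrib, ← mul_expect, Fintype.expect_const,
    expect_quadForm]
  linarith [expect_quadForm_sq_le Q hQ]

lemma norm_deriv_add_mul_le (hs : B.IsSymm) (hB : ∀ i, B i i = 0)
    (htr : (B * B).trace = 1 / 2) (u : ℝ) :
    ‖(𝔼 s, Complex.I * (signVec s ⬝ᵥ B *ᵥ signVec s : ℝ) *
        Complex.exp (Complex.I * u * (signVec s ⬝ᵥ B *ᵥ signVec s : ℝ))) +
      u * 𝔼 s, Complex.exp (Complex.I * u * (signVec s ⬝ᵥ B *ᵥ signVec s : ℝ))‖ ≤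
    48 * |u| ^ 3 * ∑ i, (∑ j, B i j ^ 2) ^ 2 +
      2 * |u| * √(2 * ∑ i, ∑ j, (B * B) i j ^ 2) := by
  set W : (Fin m → Bool) → ℝ := fun s => signVec s ⬝ᵥ B *ᵥ signVec s with hW
  set q : (Fin m → Bool) → ℝ := fun s => signVec s ⬝ᵥ (B * B) *ᵥ signVec s with hq
  have hWs : ∀ s, W s = ∑ i, signVec s i * (B *ᵥ signVec s) i := fun s => rfl
  have hqs : ∀ s, q s = ∑ i, (B *ᵥ signVec s) i ^ 2 := fun s => by
    simp only [hq]
    rw [← mulVec_mulVec, dotProduct_mulVec, ← mulVec_transpose, hs.eq]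
    simp [dotProduct, sq]
  have hsplit : (𝔼 s, Complex.I * (W s : ℝ) * Complex.exp (Complex.I * u * (W s : ℝ))) +
      u * 𝔼 s, Complex.exp (Complex.I * u * (W s : ℝ)) =
      Complex.I / 2 * (∑ i, 𝔼 s, ((2 * (signVec s i * (B *ᵥ signVec s) i) : ℝ) -
        Complex.I * u * 4 * ((B *ᵥ signVec s) i ^ 2 : ℝ)) *
        Complex.exp (Complex.I * u * (W s : ℝ))) -
      𝔼 s, 2 * u * ((q s - 1 / 2 : ℝ) : ℂ) * Complex.exp (Complex.I * u * (W s : ℝ)) := by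
    rw [← expect_sum_comm, mul_expect, mul_expect, ← expect_add_distrib, ← expect_sub_distrib]
    refine expect_congr rfl fun s _ => ?_
    rw [← Finset.sum_mul, sum_sub_distrib, ← Finset.mul_sum, ← Complex.ofReal_sum,
      ← Complex.ofReal_sum, ← hqs, ← Finset.mul_sum, ← hWs]
    push_cast
    linear_combination (2 * u * q s * Complex.exp (Complex.I * u * (W s : ℝ))) * Complex.I_sq
  rw [hsplit]
  refine (norm_sub_le _ _).trans (add_le_add ?_ ?_)
  · rw [norm_mul, norm_div, Complex.norm_I, Complex.norm_ofNat]
    have : ‖∑ i, 𝔼 s, ((2 * (signVec s i * (B *ᵥ signVec s) i) : ℝ) -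
        Complex.I * u * 4 * ((B *ᵥ signVec s) i ^ 2 : ℝ)) *
        Complex.exp (Complex.I * u * (W s : ℝ))‖ ≤
        ∑ i, 32 * |u| ^ 3 * (3 * (∑ j, B i j ^ 2) ^ 2) := by
      refine (norm_sum_le _ _).trans (sum_le_sum fun i _ => ?_)
      refine (norm_expect_stein_coord_le hs (hB i) u).trans ?_
      gcongr
      exact expect_mulVec_pow_four_le i
    simp only [← Finset.mul_sum] at this
    linarith
  · refine (RCLike.norm_expect_le (K := ℂ)).trans ?_
    have h1 : ∀ s, ‖2 * u * ((q s - 1 / 2 : ℝ) : ℂ) * Complex.exp (Complex.I * u * (W s : ℝ))‖ =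
        2 * |u| * |q s - 1 / 2| := fun s => by
      have : Complex.I * u * (W s : ℝ) = ((u * W s : ℝ) : ℂ) * Complex.I := by push_cast; ring
      rw [this, norm_mul, Complex.norm_exp_ofReal_mul_I, norm_mul, norm_mul, Complex.norm_real,
        Complex.norm_real]
      simp
    simp_rw [h1, ← mul_expect]
    gcongr
    have := expect_abs_quadForm_sub_trace_le (Q := B * B) (by
      rw [Matrix.IsSymm, transpose_mul, hs.eq])
    rwa [htr] at this

/-- Quantitative central limit theorem, at the level of characteristic functions, for the
quadratic form of a symmetric matrix with zero diagonal in independent random signs. -/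
theorem norm_expect_cexp_quadForm_sub_le (hs : B.IsSymm) (hB : ∀ i, B i i = 0)
    (htr : (B * B).trace = 1 / 2) (t : ℝ) :
    ‖(𝔼 s, Complex.exp (Complex.I * t * (signVec s ⬝ᵥ B *ᵥ signVec s : ℝ))) -
        Complex.exp (-(t ^ 2 / 2))‖ ≤
    (48 * |t| ^ 3 * ∑ i, (∑ j, B i j ^ 2) ^ 2 +
      2 * |t| * √(2 * ∑ i, ∑ j, (B * B) i j ^ 2)) * |t| := by
  refine norm_sub_exp_neg_sq_le (hasDerivAt_expect_cexp _) (by simp) fun u hu =>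
    (norm_deriv_add_mul_le hs hB htr u).trans ?_
  gcongr

end Stein

section Projection

variable {m : ℕ} {P : Matrix (Fin m) (Fin m) ℝ}

/-- The off-diagonal part of a square matrix. -/
def offDiagPart (P : Matrix (Fin m) (Fin m) ℝ) : Matrix (Fin m) (Fin m) ℝ :=
  P - diagonal P.diag

lemma offDiagPart_apply (i j : Fin m) : offDiagPart P i j = if i = j then 0 else P i j := by
  rw [offDiagPart, Matrix.sub_apply, diagonal_apply]
  split_ifs with h
  · simp [h]
  · simp

lemma offDiagPart_isSymm (hs : P.IsSymm) : (offDiagPart P).IsSymm := by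
  rw [offDiagPart, Matrix.IsSymm, transpose_sub, hs.eq, diagonal_transpose]

lemma quadForm_offDiagPart (s : Fin m → Bool) :
    signVec s ⬝ᵥ offDiagPart P *ᵥ signVec s = signVec s ⬝ᵥ P *ᵥ signVec s - P.trace := by
  rw [offDiagPart, sub_mulVec, dotProduct_sub, Matrix.trace]
  congr 1
  refine sum_congr rfl fun i _ => ?_
  rw [mulVec_diagonal]
  linear_combination P.diag i * signVec_mul_self s i

lemma trace_mul_self_eq_sum_sq {A : Matrix (Fin m) (Fin m) ℝ} (hA : A.IsSymm) :
    (A * A).trace = ∑ i, ∑ j, A i j ^ 2 := by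
  simp only [Matrix.trace, diag_apply, mul_apply, sq]
  exact sum_congr rfl fun i _ => sum_congr rfl fun j _ => by rw [hA.apply]

lemma sum_sq_row_eq_diag (hs : P.IsSymm) (hP : P * P = P) (i : Fin m) :
    ∑ j, P i j ^ 2 = P i i := by
  conv_rhs => rw [← hP, mul_apply]
  exact sum_congr rfl fun j _ => by rw [hs.apply, sq]

lemma diag_nonneg_of_projection (hs : P.IsSymm) (hP : P * P = P) (i : Fin m) : 0 ≤ P i i := by
  rw [← sum_sq_row_eq_diag hs hP]
  exact sum_nonneg fun _ _ => sq_nonneg _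

lemma diag_le_one_of_projection (hs : P.IsSymm) (hP : P * P = P) (i : Fin m) : P i i ≤ 1 := by
  have h1 : P i i ^ 2 ≤ ∑ j, P i j ^ 2 :=
    single_le_sum (f := fun j => P i j ^ 2) (fun _ _ => sq_nonneg _) (mem_univ i)
  rw [sum_sq_row_eq_diag hs hP] at h1
  by_contra! h
  nlinarith

lemma sum_sq_row_offDiagPart_le (hs : P.IsSymm) (hP : P * P = P) (i : Fin m) :
    ∑ j, offDiagPart P i j ^ 2 ≤ P i i := by
  rw [← sum_sq_row_eq_diag hs hP]
  refine sum_le_sum fun j _ => ?_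
  rw [offDiagPart_apply]
  split_ifs
  · simpa using sq_nonneg _
  · rfl

lemma sum_sq_sum_sq_row_offDiagPart_le (hs : P.IsSymm) (hP : P * P = P) :
    ∑ i, (∑ j, offDiagPart P i j ^ 2) ^ 2 ≤ P.trace := by
  refine sum_le_sum fun i _ => ?_
  have h0 : 0 ≤ ∑ j, offDiagPart P i j ^ 2 := sum_nonneg fun _ _ => sq_nonneg _
  have h1 := sum_sq_row_offDiagPart_le hs hP i
  have h2 := diag_le_one_of_projection hs hP i
  rw [diag_apply]
  nlinarith

lemma sum_sq_offDiagPart_mul_self_le (hs : P.IsSymm) (hP : P * P = P) :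
    ∑ i, ∑ j, (offDiagPart P * offDiagPart P) i j ^ 2 ≤ P.trace := by
  have hrow : P.trace = ∑ i, ∑ j, P i j ^ 2 :=
    sum_congr rfl fun i _ => (sum_sq_row_eq_diag hs hP i).symm
  rw [hrow]
  refine sum_le_sum fun i _ => sum_le_sum fun j _ => ?_
  have e : (offDiagPart P * offDiagPart P) i j =
      P i j * (1 - P i i - P j j) + if i = j then P i i * P i i else 0 := by
    rw [offDiagPart, sub_mul, mul_sub, mul_sub, hP, diagonal_mul_diagonal]
    simp only [Matrix.sub_apply, mul_diagonal, diagonal_mul, diag_apply, diagonal_apply]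
    ring
  have hi := diag_nonneg_of_projection hs hP i
  have hi' := diag_le_one_of_projection hs hP i
  have hj := diag_nonneg_of_projection hs hP j
  have hj' := diag_le_one_of_projection hs hP j
  rw [e, sq_le_sq]
  split_ifs with h
  · subst h
    rw [abs_of_nonneg hi, abs_le]
    constructor <;> nlinarith
  · rw [add_zero, abs_mul]
    exact mul_le_of_le_one_right (abs_nonneg _) (abs_le.2 ⟨by linarith, by linarith⟩)

/-- Characteristic function bound for the standardized quadratic form of a projection. -/
lemma norm_expect_cexp_projection_sub_le (hs : P.IsSymm) (hP : P * P = P) {c : ℝ} (hc : 0 < c)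
    (hk : 0 < P.trace) (hσ : c * P.trace ≤ 2 * ∑ i, ∑ j, offDiagPart P i j ^ 2) (t : ℝ) :
    ‖(𝔼 s, Complex.exp (Complex.I * t *
        (((√(2 * ∑ i, ∑ j, offDiagPart P i j ^ 2))⁻¹ *
          (signVec s ⬝ᵥ P *ᵥ signVec s - P.trace) : ℝ) : ℂ))) - Complex.exp (-(t ^ 2 / 2))‖ ≤
    (48 * |t| ^ 3 * ((c ^ 2)⁻¹ * P.trace⁻¹) +
      2 * |t| * √(2 * ((c ^ 2)⁻¹ * P.trace⁻¹))) * |t| := by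
  set A := offDiagPart P with hA
  set S := ∑ i, ∑ j, A i j ^ 2 with hS
  have hck : 0 < c * P.trace := mul_pos hc hk
  have hSpos : 0 < 2 * S := hck.trans_le hσ
  have hA_symm : A.IsSymm := offDiagPart_isSymm hs
  have hinv : ((√(2 * S))⁻¹) ^ 2 = (2 * S)⁻¹ := by
    rw [inv_pow, Real.sq_sqrt hSpos.le]
  have hBB : ((√(2 * S))⁻¹ • A) * ((√(2 * S))⁻¹ • A) = (2 * S)⁻¹ • (A * A) := by
    rw [smul_mul_smul_comm, ← sq, hinv]
  have h := norm_expect_cexp_quadForm_sub_le (B := (√(2 * S))⁻¹ • A)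
    (by rw [Matrix.IsSymm, transpose_smul, hA_symm.eq]) (fun i => by simp [hA, offDiagPart_apply])
    (by
      rw [hBB, trace_smul, trace_mul_self_eq_sum_sq hA_symm, smul_eq_mul, mul_inv, mul_assoc,
        inv_mul_cancel₀ (by linarith)]
      norm_num) t
  have hW : ∀ s : Fin m → Bool, signVec s ⬝ᵥ ((√(2 * S))⁻¹ • A) *ᵥ signVec s =
      (√(2 * S))⁻¹ * (signVec s ⬝ᵥ P *ᵥ signVec s - P.trace) := fun s => by
    rw [smul_mulVec, dotProduct_smul, smul_eq_mul, quadForm_offDiagPart]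
  simp only [hW, hBB] at h
  have hscale : ∀ x, x ≤ P.trace → ((2 * S)⁻¹) ^ 2 * x ≤ (c ^ 2)⁻¹ * P.trace⁻¹ := fun x hx => by
    calc ((2 * S)⁻¹) ^ 2 * x ≤ ((2 * S)⁻¹) ^ 2 * P.trace := by gcongr
      _ ≤ ((c * P.trace)⁻¹) ^ 2 * P.trace := by gcongr
      _ = _ := by field_simp
  have hR : ∑ i, (∑ j, ((√(2 * S))⁻¹ • A) i j ^ 2) ^ 2 ≤ (c ^ 2)⁻¹ * P.trace⁻¹ := by
    simp only [Matrix.smul_apply, smul_eq_mul, mul_pow, hinv, ← Finset.mul_sum]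
    exact hscale _ (sum_sq_sum_sq_row_offDiagPart_le hs hP)
  have hT : ∑ i, ∑ j, ((2 * S)⁻¹ • (A * A)) i j ^ 2 ≤ (c ^ 2)⁻¹ * P.trace⁻¹ := by
    simp only [Matrix.smul_apply, smul_eq_mul, mul_pow, ← Finset.mul_sum]
    exact hscale _ (sum_sq_offDiagPart_mul_self_le hs hP)
  refine h.trans ?_
  gcongr

end Projection

lemma tendsto_expect_of_tendsto_expect_cexp {ι : ℕ → Type*} [∀ n, Fintype (ι n)]
    [∀ n, Nonempty (ι n)] (W : ∀ n, ι n → ℝ)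
    (h : ∀ t : ℝ, Tendsto (fun n => 𝔼 i, Complex.exp (Complex.I * t * W n i)) atTop
      (𝓝 (Complex.exp (-(t ^ 2 / 2)))))
    (f : BoundedContinuousFunction ℝ ℝ) :
    Tendsto (fun n => 𝔼 i, f (W n i)) atTop
      (𝓝 (∫ x, f x ∂(ProbabilityTheory.gaussianReal 0 1))) := by
  let _ : ∀ n, MeasurableSpace (ι n) := fun _ => ⊤
  have hWm : ∀ n, Measurable (W n) := fun n => measurable_from_top
  let μ : ℕ → ProbabilityMeasure ℝ := fun n =>
    ⟨(PMF.uniformOfFintype (ι n)).toMeasure.map (W n),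
      Measure.isProbabilityMeasure_map (hWm n).aemeasurable⟩
  have hμ : ∀ n (E : Type) [NormedAddCommGroup E] [NormedSpace ℝ E] [CompleteSpace E]
      (g : ℝ → E), Continuous g →
      ∫ x, g x ∂(μ n : Measure ℝ) = ((Fintype.card (ι n) : ℝ))⁻¹ • ∑ i, g (W n i) := by
    intro n E _ _ _ g hg
    change ∫ x, g x ∂((PMF.uniformOfFintype (ι n)).toMeasure.map (W n)) = _
    rw [integral_map (hWm n).aemeasurable hg.aestronglyMeasurable, PMF.integral_eq_sum]
    simp [Finset.smul_sum]
  have hlim : Tendsto μ atTop (𝓝 ⟨ProbabilityTheory.gaussianReal 0 1, inferInstance⟩) := by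
    refine ProbabilityMeasure.tendsto_iff_tendsto_charFun.2 fun t => ?_
    have e : Complex.exp (-(t ^ 2 / 2)) = charFun (ProbabilityTheory.gaussianReal 0 1) t := by
      rw [ProbabilityTheory.charFun_gaussianReal]; simp
    rw [ProbabilityMeasure.coe_mk, ← e]
    refine (h t).congr fun n => ?_
    rw [charFun_apply_real, hμ n ℂ _ (by fun_prop), Fintype.expect_eq_sum_div_card,
      Complex.real_smul, div_eq_inv_mul]
    push_cast
    congr 1
    exact sum_congr rfl fun i _ => congrArg _ (by ring)
  refine (ProbabilityMeasure.tendsto_iff_forall_integral_tendsto.1 hlim f).congr fun n => ?_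
  rw [hμ n ℝ f f.continuous, Fintype.expect_eq_sum_div_card, smul_eq_mul, div_eq_inv_mul]

end

/-- Theorem 1: under reflection invariance (conditional form), the recentered and rescaled
Anderson–Rubin statistic `(k σ_n²)^{-1/2} (rᵀ P r − k)`, with `r` uniform on `{−1,1}^{m_n}`,
converges in distribution to `N(0,1)` as `k_n → ∞`. Weak convergence is expressed via
convergence of expectations of bounded continuous functions. -/
theorem stmt_0
    (m k : ℕ → ℕ)
    (hm : ∀ n, 0 < m n) (hkpos : ∀ n, 0 < k n)
    (hk : Tendsto k atTop atTop)
    (P : ∀ n, Matrix (Fin (m n)) (Fin (m n)) ℝ)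
    (hsymm : ∀ n, (P n).IsSymm)
    (hidem : ∀ n, P n * P n = P n)
    (hrank : ∀ n, (P n).rank = k n)
    (htr : ∀ n, (P n).trace = (k n : ℝ))
    (c : ℝ) (hc : 0 < c)
    (hσ : ∀ n, c ≤ (2 / (k n : ℝ)) * ∑ i, ∑ j, if i = j then 0 else (P n i j) ^ 2) :
    ∀ f : BoundedContinuousFunction ℝ ℝ,
      Tendsto (fun n =>
          ((2 : ℝ) ^ (m n))⁻¹ *
            ∑ s : Fin (m n) → Bool,
              f ((Real.sqrt ((k n : ℝ) *
                    ((2 / (k n : ℝ)) * ∑ i, ∑ j, if i = j then 0 else (P n i j) ^ 2)))⁻¹ *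
                  (signVec s ⬝ᵥ (P n).mulVec (signVec s) - (k n : ℝ))))
        atTop
        (𝓝 (∫ x, f x ∂(ProbabilityTheory.gaussianReal 0 1))) := by
  intro f
  have hS : ∀ n, (∑ i, ∑ j, if i = j then 0 else (P n i j) ^ 2) =
      ∑ i, ∑ j, offDiagPart (P n) i j ^ 2 := fun n => by
    refine Finset.sum_congr rfl fun i _ => Finset.sum_congr rfl fun j _ => ?_
    rw [offDiagPart_apply]
    split_ifs <;> simp
  have hk0 : ∀ n, (0 : ℝ) < k n := fun n => by exact_mod_cast hkpos n
  have hvar : ∀ n, (k n : ℝ) *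
      ((2 / (k n : ℝ)) * ∑ i, ∑ j, if i = j then 0 else (P n i j) ^ 2) =
      2 * ∑ i, ∑ j, offDiagPart (P n) i j ^ 2 := fun n => by
    have := (hk0 n).ne'
    rw [hS]
    field_simp
  have hσ' : ∀ n, c * (P n).trace ≤ 2 * ∑ i, ∑ j, offDiagPart (P n) i j ^ 2 := fun n => by
    rw [← hvar, htr, mul_comm]
    exact mul_le_mul_of_nonneg_left (hσ n) (hk0 n).le
  have hlim := tendsto_expect_of_tendsto_expect_cexp
    (fun n (s : Fin (m n) → Bool) => (√(2 * ∑ i, ∑ j, offDiagPart (P n) i j ^ 2))⁻¹ *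
      (signVec s ⬝ᵥ P n *ᵥ signVec s - (P n).trace)) (fun t => ?_) f
  · refine hlim.congr fun n => ?_
    rw [Fintype.expect_eq_sum_div_card, div_eq_inv_mul, hvar, htr]
    simp
  · rw [tendsto_iff_norm_sub_tendsto_zero]
    refine squeeze_zero (fun _ => norm_nonneg _) (fun n => norm_expect_cexp_projection_sub_le
      (hsymm n) (hidem n) hc (by rw [htr]; exact hk0 n) (hσ' n) t) ?_
    have hinv : Tendsto (fun n => (c ^ 2)⁻¹ * ((P n).trace)⁻¹) atTop (𝓝 0) := by
      simp only [htr]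
      simpa using (tendsto_inv_atTop_zero.comp
        ((tendsto_natCast_atTop_atTop (R := ℝ)).comp hk)).const_mul (c ^ 2)⁻¹
    have hcont : Continuous fun x : ℝ =>
        (48 * |t| ^ 3 * x + 2 * |t| * √(2 * x)) * |t| := by fun_prop
    simpa [Function.comp_def] using (hcont.tendsto 0).comp hinv
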